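/- Let u be C² on a domain D ⊆ ℝ^m (m ≥ 2) and μ ≠ 0 a real number. Then u satisfies Δu = μ²u on D if and only if for every x ∈ D, lim_{r→0⁺} (M•(u, B_r(x)) − u(x))/r² = μ² u(x)/(2(m+2)). -/

import Mathlib

open MeasureTheory Metric Filter Real
open scoped Topology ENNReal

noncomputable def ballMean (m : ℕ) (u : EuclideanSpace ℝ (Fin m) → ℝ)
    (x : EuclideanSpace ℝ (Fin m)) (r : ℝ) : ℝ :=
  ⨍ y in ball x r, u y

noncomputable def lap (m : ℕ) (u : EuclideanSpace ℝ (Fin m) → ℝ)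
    (x : EuclideanSpace ℝ (Fin m)) : ℝ :=
  ∑ i : Fin m, fderiv ℝ (fun y => fderiv ℝ u y (EuclideanSpace.single i 1)) x
    (EuclideanSpace.single i 1)

abbrev EE (m : ℕ) := EuclideanSpace ℝ (Fin m)

theorem int_iso {m : ℕ} (e : EE m ≃ₗᵢ[ℝ] EE m) (f : EE m → ℝ) (r : ℝ) :
    ∫ y in ball (0 : EE m) r, f (e y) = ∫ y in ball (0 : EE m) r, f y := by
  have h := (e.measurePreserving).setIntegral_preimage_emb
    e.toHomeomorph.measurableEmbedding f (ball 0 r)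
  rw [← h]
  congr 2
  ext y
  simp

theorem int_tr {m : ℕ} (x : EE m) (f : EE m → ℝ) (r : ℝ) :
    ∫ y in ball x r, f y = ∫ y in ball (0 : EE m) r, f (x + y) := by
  have h := (measurePreserving_add_left volume x).setIntegral_preimage_emb
    (Homeomorph.addLeft x).measurableEmbedding f (ball x r)
  rw [← h]
  congr 2
  ext y
  simp

theorem int_lin {m : ℕ} (L : EE m →L[ℝ] ℝ) (r : ℝ) :
    ∫ y in ball (0 : EE m) r, L y = 0 := by
  have h := int_iso (LinearIsometryEquiv.neg ℝ) (fun y : EE m => L y) r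
  simp [integral_neg] at h
  linarith

theorem int_off {m : ℕ} (i j : Fin m) (hij : i ≠ j) (r : ℝ) :
    ∫ y in ball (0 : EE m) r, y i * y j = 0 := by
  have h := int_iso (LinearIsometryEquiv.piLpCongrRight 2 (fun k : Fin m =>
    if k = i then LinearIsometryEquiv.neg ℝ else LinearIsometryEquiv.refl ℝ ℝ))
     (fun y : EE m => y i * y j) r
  simp [integral_neg, hij.symm] at h
  linarith

theorem int_swap {m : ℕ} (i j : Fin m) (r : ℝ) :
    ∫ y in ball (0 : EE m) r, y i * y i = ∫ y in ball (0 : EE m) r, y j * y j := by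
  have h := int_iso (LinearIsometryEquiv.piLpCongrLeft 2 ℝ ℝ (Equiv.swap i j))
     (fun y : EE m => y j * y j) r
  rw [← h]
  simp [LinearIsometryEquiv.piLpCongrLeft_apply, Equiv.piCongrLeft'_apply]

theorem int_norm {m : ℕ} (hm : 2 ≤ m) (r : ℝ) (hr : 0 < r) :
    ∫ y in ball (0 : EE m) r, ‖y‖ ^ 2 = volume.real (ball (0 : EE m) r) * (m * r ^ 2 / (m + 2)) := by
  have : Nonempty (Fin m) := ⟨⟨0, by omega⟩⟩
  have h := integral_fun_norm_addHaar (volume : Measure (EE m))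
    (fun t => (Set.Iio r).indicator (fun t => t ^ 2) t)
  have h1 : ∀ y : EE m, (Set.Iio r).indicator (fun t => t ^ 2) ‖y‖
      = (ball (0 : EE m) r).indicator (fun y => ‖y‖ ^ 2) y := by
    intro y
    simp [Set.indicator]
  simp_rw [h1] at h
  rw [integral_indicator measurableSet_ball] at h
  rw [h, measureReal_def, measureReal_def, Measure.addHaar_ball_of_pos _ _ hr]
  have h2 : ∫ y in Set.Ioi (0 : ℝ), y ^ (Module.finrank ℝ (EE m) - 1) •
      (Set.Iio r).indicator (fun t => t ^ 2) y = r ^ (m + 2) / (m + 2) := by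
    have : ∀ y : ℝ, y ^ (Module.finrank ℝ (EE m) - 1) •
      (Set.Iio r).indicator (fun t => t ^ 2) y
        = (Set.Iio r).indicator (fun t => t ^ (m + 1)) y := by
      intro y
      simp only [Set.indicator, finrank_euclideanSpace_fin]
      split_ifs
      · rw [smul_eq_mul, ← pow_add]; congr 1; omega
      · simp
    simp_rw [this]
    rw [setIntegral_indicator measurableSet_Iio, Set.Ioi_inter_Iio, ← integral_Ioc_eq_integral_Ioo,
      ← intervalIntegral.integral_of_le hr.le, integral_pow]
    simp
    ring
  rw [h2]
  rw [ENNReal.toReal_mul, ENNReal.toReal_ofReal (by positivity)]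
  simp only [finrank_euclideanSpace_fin, nsmul_eq_mul, smul_eq_mul]
  ring

theorem intble {m : ℕ} {f : EE m → ℝ} (r : ℝ) (hf : Continuous f) :
    IntegrableOn f (ball (0 : EE m) r) :=
  (hf.continuousOn.integrableOn_compact (isCompact_closedBall 0 r)).mono_set ball_subset_closedBall

theorem int_diag {m : ℕ} (hm : 2 ≤ m) (r : ℝ) (hr : 0 < r) (i : Fin m) :
    ∫ y in ball (0 : EE m) r, y i * y i = volume.real (ball (0 : EE m) r) * (r ^ 2 / (m + 2)) := by
  have h := int_norm hm r hr
  simp_rw [EuclideanSpace.real_norm_sq_eq] at h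
  rw [integral_finsetSum _ (fun j _ => intble r (by fun_prop))] at h
  rw [Finset.sum_congr rfl (fun j _ => (by
    simp_rw [pow_two]
    exact int_swap j i r : ∫ y in ball (0 : EE m) r, (y j) ^ 2
      = ∫ y in ball (0 : EE m) r, y i * y i))] at h
  simp only [Finset.sum_const, Finset.card_univ, Fintype.card_fin, nsmul_eq_mul] at h
  have hm0 : (m : ℝ) ≠ 0 := by
    have : m ≠ 0 := by omega
    exact_mod_cast this
  apply mul_left_cancel₀ hm0
  rw [h]
  ring

theorem int_quad {m : ℕ} (hm : 2 ≤ m) (r : ℝ) (hr : 0 < r) (B : EE m →L[ℝ] EE m →L[ℝ] ℝ) :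
    ∫ y in ball (0 : EE m) r, B y y = volume.real (ball (0 : EE m) r) * (r ^ 2 / (m + 2)) *
      ∑ i : Fin m, B (EuclideanSpace.single i 1) (EuclideanSpace.single i 1) := by
  have hB : ∀ y : EE m, B y y = ∑ i : Fin m, ∑ j : Fin m,
      (y i * y j) * B (EuclideanSpace.single i 1) (EuclideanSpace.single j 1) := by
    intro y
    have hy : y = ∑ i : Fin m, y i • (EuclideanSpace.single i (1 : ℝ) : EE m) := by
      ext k
      simp [Finset.sum_apply, Pi.single_apply]
    conv_lhs => rw [hy]
    simp only [map_sum, map_smul, _root_.sum_apply, _root_.smul_apply,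
      smul_eq_mul, Finset.mul_sum]
    rw [Finset.sum_comm]
    refine Finset.sum_congr rfl fun i _ => Finset.sum_congr rfl fun j _ => ?_
    ring
  rw [setIntegral_congr_fun measurableSet_ball (fun y _ => hB y)]
  rw [integral_finsetSum _ (fun j _ => intble r (by fun_prop)), Finset.mul_sum]
  refine Finset.sum_congr rfl fun i _ => ?_
  rw [integral_finsetSum _ (fun j _ => intble r (by fun_prop))]
  simp_rw [integral_mul_const]
  rw [Finset.sum_eq_single i, int_diag hm r hr]
  · intro j _ hj
    rw [int_off i j hj.symm, zero_mul]
  · simp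

theorem taylor2 {m : ℕ} {u : EE m → ℝ} {x : EE m} (hu : ContDiffAt ℝ 2 u x) (ε : ℝ) (hε : 0 < ε) :
    ∃ δ > 0, ∀ h : EE m, ‖h‖ < δ →
      |u (x + h) - u x - fderiv ℝ u x h - (1 / 2) * fderiv ℝ (fderiv ℝ u) x h h| ≤ ε * ‖h‖ ^ 2 := by
  have hsym := hu.isSymmSndFDerivAt (by simp)
  have hd : ∀ᶠ y in 𝓝 x, DifferentiableAt ℝ u y := by
    filter_upwards [hu.eventually (by simp)] with y hy
    exact hy.differentiableAt (by simp)
  have hd2 : DifferentiableAt ℝ (fderiv ℝ u) x :=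
    (hu.fderiv_right (m := 1) (by norm_num)).differentiableAt (by simp)
  have hlo := hd2.hasFDerivAt.isLittleO.def hε
  obtain ⟨δ, hδ, H⟩ := Metric.eventually_nhds_iff_ball.1 (hd.and hlo)
  refine ⟨δ, hδ, fun h hh => ?_⟩
  set B := fderiv ℝ (fderiv ℝ u) x with hBdef
  set L := fderiv ℝ u x with hL
  have hder : ∀ k ∈ closedBall (0 : EE m) ‖h‖,
      HasFDerivWithinAt (fun k => u (x + k) - u x - L k - (1 / 2) * B k k)
        (fderiv ℝ u (x + k) - L - B k) (closedBall (0 : EE m) ‖h‖) k := by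
    intro k hk
    have hk' : x + k ∈ ball x δ := by
      simp at hk ⊢
      linarith
    have h1 : HasFDerivAt (fun k => u (x + k)) (fderiv ℝ u (x + k)) k := by
      have := (H _ hk').1.hasFDerivAt
      exact (hasFDerivAt_comp_add_left x).2 this
    have h2 : HasFDerivAt (fun k => B k k) (B k + B.flip k) k := by
      have := B.hasFDerivAt.clm_apply (hasFDerivAt_id (𝕜 := ℝ) k)
      exact this
    have h3 : B.flip k = B k := by
      ext v
      exact hsym v k
    rw [h3] at h2
    have h4 := ((h1.sub_const (u x)).sub L.hasFDerivAt).sub (h2.const_mul (1 / 2))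
    have h5 : fderiv ℝ u (x + k) - L - B k
        = fderiv ℝ u (x + k) - L - (1 / 2 : ℝ) • (B k + B k) := by
      rw [← two_smul ℝ (B k), smul_smul]
      norm_num
    rw [h5]
    exact h4.hasFDerivWithinAt
  have hbd : ∀ k ∈ closedBall (0 : EE m) ‖h‖, ‖fderiv ℝ u (x + k) - L - B k‖ ≤ ε * ‖h‖ := by
    intro k hk
    have hk' : x + k ∈ ball x δ := by
      simp at hk ⊢
      linarith
    have := (H _ hk').2
    simp only [add_sub_cancel_left] at this
    refine this.trans ?_
    gcongr
    simpa using hk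
  have := (convex_closedBall (0 : EE m) ‖h‖).norm_image_sub_le_of_norm_hasFDerivWithin_le hder hbd
    (x := 0) (y := h) (by simp) (by simp)
  simp only [add_zero, map_zero, sub_self, mul_zero, sub_zero, Real.norm_eq_abs] at this
  rw [pow_two, ← mul_assoc]
  exact this

theorem lap_eq {m : ℕ} {u : EE m → ℝ} {x : EE m} (hu : ContDiffAt ℝ 2 u x) :
    lap m u x = ∑ i : Fin m, fderiv ℝ (fderiv ℝ u) x (EuclideanSpace.single i 1)
      (EuclideanSpace.single i 1) := by
  have hd2 : DifferentiableAt ℝ (fderiv ℝ u) x :=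
    (hu.fderiv_right (m := 1) (by norm_num)).differentiableAt (by simp)
  unfold lap
  refine Finset.sum_congr rfl fun i _ => ?_
  rw [fderiv_clm_apply hd2 (differentiableAt_const _)]
  simp

theorem key {m : ℕ} (hm : 2 ≤ m) {D : Set (EE m)} (hD : IsOpen D) {u : EE m → ℝ}
    (hu : ContDiffOn ℝ 2 u D) {x : EE m} (hx : x ∈ D) :
    Tendsto (fun r => (ballMean m u x r - u x) / r ^ 2) (𝓝[>] 0)
        (𝓝 (lap m u x / (2 * (m + 2)))) := by
  have hux : ContDiffAt ℝ 2 u x := hu.contDiffAt (hD.mem_nhds hx)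
  obtain ⟨ρ, hρ, hρD⟩ := Metric.isOpen_iff.1 hD x hx
  rw [Metric.tendsto_nhds]
  intro ε hε
  obtain ⟨δ, hδ, H⟩ := taylor2 hux (ε / 2) (by positivity)
  filter_upwards [Ioo_mem_nhdsGT (lt_min hρ hδ)] with r hr
  obtain ⟨hr0, hr1⟩ := hr
  have hrρ := hr1.trans_le (min_le_left _ _)
  have hrδ := hr1.trans_le (min_le_right _ _)
  set V := volume.real (ball (0 : EE m) r) with hV
  have hVpos : 0 < V := ENNReal.toReal_pos (measure_ball_pos _ _ hr0).ne' measure_ball_lt_top.ne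
  have hui : IntegrableOn (fun y => u (x + y)) (ball (0 : EE m) r) := by
    have : ContinuousOn (fun y => u (x + y)) (closedBall (0 : EE m) r) := by
      refine hu.continuousOn.comp (by fun_prop) fun y hy => hρD ?_
      simp at hy ⊢
      linarith
    exact (this.integrableOn_compact (isCompact_closedBall 0 r)).mono_set ball_subset_closedBall
  have hR := norm_setIntegral_le_of_norm_le_const (μ := volume) (s := ball (0 : EE m) r)
    (f := fun h => u (x + h) - u x - fderiv ℝ u x h - (1 / 2) * fderiv ℝ (fderiv ℝ u) x h h)
    (C := ε / 2 * r ^ 2) measure_ball_lt_top (by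
      intro h hh
      simp only [mem_ball, dist_zero_right] at hh
      refine (H h (hh.trans hrδ)).trans ?_
      gcongr)
  have i0 : IntegrableOn (fun _ : EE m => u x) (ball (0 : EE m) r) := intble r (by fun_prop)
  have i1 : IntegrableOn (fun h : EE m => fderiv ℝ u x h) (ball (0 : EE m) r) :=
    intble r (by fun_prop)
  have i2 : IntegrableOn (fun h : EE m => (1 / 2) * fderiv ℝ (fderiv ℝ u) x h h)
    (ball (0 : EE m) r) := intble r (by fun_prop)
  have j1 : IntegrableOn (fun y => u (x + y) - u x) (ball (0 : EE m) r) := hui.sub i0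
  have j2 : IntegrableOn (fun y => u (x + y) - u x - fderiv ℝ u x y) (ball (0 : EE m) r) :=
    j1.sub i1
  rw [integral_sub j2 i2, integral_sub j1 i1, integral_sub hui i0,
    int_lin, integral_const_mul, int_quad hm r hr0, ← lap_eq hux, setIntegral_const, ← hV,
    Real.norm_eq_abs, ← int_tr] at hR
  have hM : ballMean m u x r = V⁻¹ * ∫ y in ball x r, u y := by
    rw [ballMean, setAverage_eq, Measure.addHaar_real_ball_center, smul_eq_mul]
  rw [Real.dist_eq, hM]
  have e : (V⁻¹ * (∫ y in ball x r, u y) - u x) / r ^ 2 - lap m u x / (2 * (m + 2))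
      = ((∫ y in ball x r, u y) - V • u x - 0 - 1 / 2 * (V * (r ^ 2 / (m + 2)) * lap m u x))
        / (V * r ^ 2) := by
    rw [smul_eq_mul]
    field_simp
    ring
  rw [e, abs_div, abs_of_pos (by positivity : 0 < V * r ^ 2), div_lt_iff₀ (by positivity)]
  refine hR.trans_lt ?_
  have : 0 < ε * (V * r ^ 2) := by positivity
  nlinarith

theorem stmt2 (m : ℕ) (hm : 2 ≤ m) (D : Set (EuclideanSpace ℝ (Fin m))) (hD : IsOpen D)
    (u : EuclideanSpace ℝ (Fin m) → ℝ) (hu : ContDiffOn ℝ 2 u D) (hDc : IsConnected D) (μ : ℝ) (hμ : μ ≠ 0) :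
    (∀ x ∈ D, lap m u x = μ ^ 2 * u x) ↔
      ∀ x ∈ D, Tendsto (fun r => (ballMean m u x r - u x) / r ^ 2) (𝓝[>] 0)
        (𝓝 (μ ^ 2 * u x / (2 * (m + 2)))) := by
  constructor
  · intro h x hx
    rw [← h x hx]
    exact key hm hD hu hx
  · intro h x hx
    have h1 := tendsto_nhds_unique (key hm hD hu hx) (h x hx)
    have h2 : (2 * ((m : ℝ) + 2)) ≠ 0 := by positivity
    exact (div_left_inj' h2).1 h1
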